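/- Let α : ℤ → ℂ with |α n| < 1, a ≤ b integers, β, γ ∈ ∂𝔻, and x, y ∈ ℝ. Define α̃ n = e(n·x + y)·α n, β̃ = e((a−1)·x + y)·β, and γ̃ = e(b·x + y)·γ. Then the finite CMV matrices ℰ^{[a,b]}_{β,γ} (built from α, β, γ) and e(x)·ℰ̃^{[a,b]}_{β̃,γ̃} (built from α̃, β̃, γ̃) are unitarily equivalent: there exists a unitary (b−a+1)×(b−a+1) matrix W with e(x)·ℰ̃^{[a,b]}_{β̃,γ̃} = W · ℰ^{[a,b]}_{β,γ} · W*. -/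

import Mathlib

open scoped ComplexConjugate Matrix

noncomputable section

namespace CMV

/-- `e t = exp(2πi t)`. -/
def e (t : ℝ) : ℂ := Complex.exp (2 * Real.pi * Complex.I * t)

/-- `ρ n = (1 - |α n|^2)^{1/2}`, as a complex number. -/
def rho (α : ℤ → ℂ) (n : ℤ) : ℂ := ((1 - ‖α n‖ ^ 2).sqrt : ℝ)

/-- Entries of the doubly infinite matrix `𝓛 = ⊕_{n even} Θ n`. -/
def cmvL (α : ℤ → ℂ) (i j : ℤ) : ℂ :=
  if Even i ∧ j = i then conj (α i)
  else if Even i ∧ j = i + 1 then rho α i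
  else if Even j ∧ i = j + 1 then rho α j
  else if Odd i ∧ j = i then -α (i - 1)
  else 0

/-- Entries of the doubly infinite matrix `𝓜 = ⊕_{n odd} Θ n`. -/
def cmvM (α : ℤ → ℂ) (i j : ℤ) : ℂ :=
  if Odd i ∧ j = i then conj (α i)
  else if Odd i ∧ j = i + 1 then rho α i
  else if Odd j ∧ i = j + 1 then rho α j
  else if Even i ∧ j = i then -α (i - 1)
  else 0

/-- Coefficients modified at both boundaries: `α̃ (a-1) = β`, `α̃ b = γ`. -/
def modA (α : ℤ → ℂ) (a b : ℤ) (β γ : ℂ) (n : ℤ) : ℂ :=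
  if n = a - 1 then β else if n = b then γ else α n

/-- Coefficients modified only at the left boundary (`•` on the right). -/
def modL (α : ℤ → ℂ) (a : ℤ) (β : ℂ) (n : ℤ) : ℂ :=
  if n = a - 1 then β else α n

/-- Coefficients modified only at the right boundary (`•` on the left). -/
def modR (α : ℤ → ℂ) (b : ℤ) (γ : ℂ) (n : ℤ) : ℂ :=
  if n = b then γ else α n

/-- Principal submatrix of `𝓛` on rows and columns `{a, …, b}`. -/
def subL (αm : ℤ → ℂ) (a b : ℤ) : Matrix (Set.Icc a b) (Set.Icc a b) ℂ :=
  fun i j => cmvL αm i j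

/-- Principal submatrix of `𝓜` on rows and columns `{a, …, b}`. -/
def subM (αm : ℤ → ℂ) (a b : ℤ) : Matrix (Set.Icc a b) (Set.Icc a b) ℂ :=
  fun i j => cmvM αm i j

/-- The finite CMV matrix `ℰ^{[a,b]}`. -/
def cmvE (αm : ℤ → ℂ) (a b : ℤ) : Matrix (Set.Icc a b) (Set.Icc a b) ℂ :=
  subL αm a b * subM αm a b

/-- `φ^{[a,b]}` as a polynomial: the characteristic polynomial of the finite CMV
matrix built from the (modified) coefficients `αm`, normalized by the unmodified
`ρ`'s of `α`. -/
def phiP (α αm : ℤ → ℂ) (a b : ℤ) : Polynomial ℂ :=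
  Polynomial.C (∏ n ∈ Finset.Icc a b, rho α n)⁻¹ * (cmvE αm a b).charpoly

end CMV

open CMV

namespace CMV

lemma e_add (s t : ℝ) : e (s + t) = e s * e t := by
  simp only [e, ← Complex.exp_add]
  push_cast
  ring_nf

lemma e_zero : e 0 = 1 := by simp [e]

lemma norm_e (t : ℝ) : ‖e t‖ = 1 := by
  have h : e t = Complex.exp ((2 * Real.pi * t : ℝ) * Complex.I) := by
    simp only [e]
    push_cast
    ring_nf
  rw [h, Complex.norm_exp_ofReal_mul_I]

lemma conj_e (t : ℝ) : conj (e t) = e (-t) := by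
  simp only [e, ← Complex.exp_conj, map_mul, Complex.conj_ofReal, Complex.conj_I, map_ofNat]
  push_cast
  ring_nf

/-- Phases of the diagonal unitary that intertwines the two CMV matrices. -/
def rowPhase (x y : ℝ) (n : ℤ) : ℝ :=
  if Even n then -(n / 2 * x) else (n - 1) / 2 * x + y

/-- Phases of the diagonal unitary inserted between the factors `𝓛` and `𝓜`. -/
def midPhase (x y : ℝ) (n : ℤ) : ℝ :=
  if Even n then -rowPhase x y n - (n * x + y)
  else -rowPhase x y n + ((n - 1) * x + y)

lemma rho_of_rotated {α αt : ℤ → ℂ} {x y : ℝ}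
    (h : ∀ n : ℤ, αt n = e (n * x + y) * α n) (n : ℤ) : rho αt n = rho α n := by
  simp [rho, h, norm_e]

lemma cmvL_of_rotated {α αt : ℤ → ℂ} {x y : ℝ}
    (h : ∀ n : ℤ, αt n = e (n * x + y) * α n) (i j : ℤ) :
    cmvL αt i j = e (rowPhase x y i) * cmvL α i j * e (midPhase x y j) := by
  have key : ∀ (s t r : ℝ) (z : ℂ), r = s + t → e r * z = e s * z * e t := by
    rintro s t r z rfl
    rw [e_add]
    ring
  have key' : ∀ (s t : ℝ) (z : ℂ), 0 = s + t → z = e s * z * e t := by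
    intro s t z hst
    rw [← key s t 0 z hst, e_zero, one_mul]
  unfold cmvL
  split_ifs with h₁ h₂ h₃ h₄
  · obtain ⟨hi, rfl⟩ := h₁
    rw [h, map_mul, conj_e]
    apply key
    simp only [rowPhase, midPhase, if_pos hi]
    ring
  · obtain ⟨hi, rfl⟩ := h₂
    have hi' : ¬ Even (i + 1) := by simpa [Int.even_add_one] using hi
    rw [rho_of_rotated h]
    apply key'
    simp only [rowPhase, midPhase, if_pos hi, if_neg hi']
    push_cast
    ring
  · obtain ⟨hj, rfl⟩ := h₃
    have hj' : ¬ Even (j + 1) := by simpa [Int.even_add_one] using hj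
    rw [rho_of_rotated h]
    apply key'
    simp only [rowPhase, midPhase, if_pos hj, if_neg hj']
    push_cast
    ring
  · obtain ⟨hi, rfl⟩ := h₄
    rw [h, ← mul_neg]
    apply key
    simp only [rowPhase, midPhase, if_neg (Int.not_even_iff_odd.mpr hi)]
    push_cast
    ring
  · simp

lemma cmvM_of_rotated {α αt : ℤ → ℂ} {x y : ℝ}
    (h : ∀ n : ℤ, αt n = e (n * x + y) * α n) (i j : ℤ) :
    e x * cmvM αt i j = e (-midPhase x y i) * cmvM α i j * e (-rowPhase x y j) := by
  have key : ∀ (s t r : ℝ) (z : ℂ), x + r = s + t →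
      e x * (e r * z) = e s * z * e t := by
    intro s t r z hst
    rw [← mul_assoc, ← e_add, hst, e_add]
    ring
  have key' : ∀ (s t : ℝ) (z : ℂ), x = s + t → e x * z = e s * z * e t := by
    intro s t z hst
    rw [hst, e_add]
    ring
  unfold cmvM
  split_ifs with h₁ h₂ h₃ h₄
  · obtain ⟨hi, rfl⟩ := h₁
    rw [h, map_mul, conj_e]
    apply key
    simp only [rowPhase, midPhase, if_neg (Int.not_even_iff_odd.mpr hi)]
    ring
  · obtain ⟨hi, rfl⟩ := h₂
    rw [rho_of_rotated h]
    apply key'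
    simp only [rowPhase, midPhase, if_neg (Int.not_even_iff_odd.mpr hi), if_pos hi.add_one]
    push_cast
    ring
  · obtain ⟨hj, rfl⟩ := h₃
    rw [rho_of_rotated h]
    apply key'
    simp only [rowPhase, midPhase, if_neg (Int.not_even_iff_odd.mpr hj), if_pos hj.add_one]
    push_cast
    ring
  · obtain ⟨hi, rfl⟩ := h₄
    rw [h, ← mul_neg]
    apply key
    simp only [rowPhase, midPhase, if_pos hi]
    push_cast
    ring
  · simp

lemma cmvE_of_rotated {α αt : ℤ → ℂ} {x y : ℝ}
    (h : ∀ n : ℤ, αt n = e (n * x + y) * α n) (a b : ℤ) (i j : Set.Icc a b) :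
    e x * cmvE αt a b i j =
      e (rowPhase x y i) * cmvE α a b i j * e (-rowPhase x y j) := by
  simp only [cmvE, Matrix.mul_apply, Finset.mul_sum, Finset.sum_mul, subL, subM]
  refine Finset.sum_congr rfl fun k _ => ?_
  have hk : e (midPhase x y k) * e (-midPhase x y k) = 1 := by
    rw [← e_add, add_neg_cancel, e_zero]
  rw [cmvL_of_rotated h, mul_left_comm, cmvM_of_rotated h]
  linear_combination (e (rowPhase x y i) * cmvL α i k * cmvM α k j *
    e (-rowPhase x y j)) * hk

end CMV

/-- With `α̃ n = e(nx+y) α n`, `β̃ = e((a−1)x+y) β`, `γ̃ = e(bx+y) γ`,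
the finite CMV matrices `ℰ^{[a,b]}_{β,γ}` and `e(x)·ℰ̃^{[a,b]}_{β̃,γ̃}` are unitarily
equivalent. -/
theorem stmt10 (α : ℤ → ℂ) (hα : ∀ n, ‖α n‖ < 1) (a b : ℤ) (hab : a ≤ b)
    (β γ : ℂ) (hβ : ‖β‖ = 1) (hγ : ‖γ‖ = 1) (x y : ℝ)
    (αt : ℤ → ℂ) (hαt : ∀ n : ℤ, αt n = e ((n : ℝ) * x + y) * α n)
    (βt γt : ℂ) (hβt : βt = e (((a : ℝ) - 1) * x + y) * β)
    (hγt : γt = e ((b : ℝ) * x + y) * γ) :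
    ∃ W : Matrix (Set.Icc a b) (Set.Icc a b) ℂ,
      W * Wᴴ = 1 ∧ Wᴴ * W = 1 ∧
      e x • cmvE (modA αt a b βt γt) a b = W * cmvE (modA α a b β γ) a b * Wᴴ := by
  have h : ∀ n : ℤ, modA αt a b βt γt n = e (n * x + y) * modA α a b β γ n := by
    intro n
    unfold modA
    split_ifs with h₁ h₂
    · rw [hβt, h₁]
      push_cast
      rfl
    · rw [hγt, h₂]
    · exact hαt n
  have hW : (fun i : Set.Icc a b => e (rowPhase x y i) * e (-rowPhase x y i)) =
      fun _ => 1 := by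
    funext i
    rw [← e_add, add_neg_cancel, e_zero]
  have hstar : (Matrix.diagonal fun i : Set.Icc a b => e (rowPhase x y i))ᴴ =
      Matrix.diagonal fun i : Set.Icc a b => e (-rowPhase x y i) := by
    rw [Matrix.diagonal_conjTranspose]
    congr 1
    funext i
    exact conj_e _
  refine ⟨Matrix.diagonal fun i => e (rowPhase x y i), ?_, ?_, ?_⟩
  · rw [hstar, Matrix.diagonal_mul_diagonal, hW, Matrix.diagonal_one]
  · rw [hstar, Matrix.diagonal_mul_diagonal]
    simp_rw [mul_comm (e (-_))]
    rw [hW, Matrix.diagonal_one]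
  · rw [hstar]
    ext i j
    rw [Matrix.smul_apply, smul_eq_mul, Matrix.mul_diagonal, Matrix.diagonal_mul]
    exact cmvE_of_rotated h a b i j
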